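/- Let p, v ∈ ℝⁿ with v ≠ 0 and θ ∈ (0, π/2). Then every proper harmonic map f : ℝᵐ → ℝⁿ (m ≥ 1) whose image is contained in the open cone {x ∈ ℝⁿ : ⟨x − p, v⟩ > cos(θ)·‖x − p‖·‖v‖} is constant. -/

import Mathlib

open Metric Real RealInnerProductSpace

/-- A map `f : ℝᵐ → ℝⁿ` is harmonic if it is `C²` and its Laplacian vanishes. -/
def IsHarmonicMap {m n : ℕ}
    (f : EuclideanSpace ℝ (Fin m) → EuclideanSpace ℝ (Fin n)) : Prop :=
  ContDiff ℝ 2 f ∧ ∀ x, ∑ i : Fin m,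
    fderiv ℝ (fun y => fderiv ℝ f y (EuclideanSpace.single i 1)) x
      (EuclideanSpace.single i 1) = 0

/-- Second-order necessary condition for a local minimum on the line. -/
theorem IsLocalMin.deriv_deriv_nonneg {φ : ℝ → ℝ} {a : ℝ} (h : IsLocalMin φ a)
    (hc : ContinuousAt φ a) : 0 ≤ deriv (deriv φ) a := by
  by_contra! hneg
  have hmax : IsLocalMax φ a := isLocalMax_of_deriv_deriv_neg hneg h.deriv_eq_zero hc
  have hconst : φ =ᶠ[nhds a] fun _ => φ a := by
    filter_upwards [h, hmax] with t h₁ h₂ using le_antisymm h₂ h₁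
  have hzero : deriv (deriv φ) a = 0 := by
    rw [hconst.deriv.deriv_eq]
    simp
  exact hneg.ne hzero

/-- Second-order necessary condition for a local minimum, in the direction `e`. -/
theorem IsLocalMin.fderiv_fderiv_nonneg {E : Type*} [NormedAddCommGroup E] [NormedSpace ℝ E]
    {g : E → ℝ} {x : E} (h : IsLocalMin g x) (hg : ContDiff ℝ 2 g) (e : E) :
    0 ≤ fderiv ℝ (fun y => fderiv ℝ g y e) x e := by
  have hline (t : ℝ) : HasDerivAt (fun s : ℝ => x + s • e) e t := by
    simpa using ((hasDerivAt_id t).smul_const e).const_add x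
  have hg' : Differentiable ℝ (fun y => fderiv ℝ g y e) :=
    ((hg.fderiv_right (m := 1) (by norm_num)).clm_apply contDiff_const).differentiable
      (by norm_num)
  have hderiv : deriv (fun t : ℝ => g (x + t • e)) = fun t => fderiv ℝ g (x + t • e) e := by
    funext t
    exact ((hg.differentiable (by norm_num) _).hasFDerivAt.comp_hasDerivAt t (hline t)).deriv
  have hderiv₂ : deriv (fun t : ℝ => fderiv ℝ g (x + t • e) e) 0
      = fderiv ℝ (fun y => fderiv ℝ g y e) x e := by
    simpa [Function.comp_def] using ((hg' _).hasFDerivAt.comp_hasDerivAt 0 (hline 0)).deriv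
  have hcont : ContinuousAt (fun t : ℝ => x + t • e) 0 := (hline 0).continuousAt
  have hmin : IsLocalMin (fun t : ℝ => g (x + t • e)) 0 := by
    have h₀ : IsLocalMin g (x + (0 : ℝ) • e) := by simpa using h
    exact hcont.eventually h₀
  have := hmin.deriv_deriv_nonneg (hg.continuous.continuousAt.comp hcont)
  rwa [hderiv, hderiv₂] at this

/-- The second directional derivative of `⟪v, f - p⟫ - ε ‖·‖²` in a unit direction. -/
theorem fderiv_fderiv_inner_sub_norm_sq {E F : Type*}
    [NormedAddCommGroup E] [InnerProductSpace ℝ E] [NormedAddCommGroup F] [InnerProductSpace ℝ F]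
    {f : E → F} (hf : ContDiff ℝ 2 f) (p v : F) (ε : ℝ) (x e : E) (he : ‖e‖ = 1) :
    fderiv ℝ (fun y => fderiv ℝ (fun z => ⟪v, f z - p⟫ - ε * ‖z‖ ^ 2) y e) x e
      = ⟪v, fderiv ℝ (fun y => fderiv ℝ f y e) x e⟫ - 2 * ε := by
  have hf' : Differentiable ℝ (fun y => fderiv ℝ f y e) :=
    ((hf.fderiv_right (m := 1) (by norm_num)).clm_apply contDiff_const).differentiable
      (by norm_num)
  have hfirst : (fun y => fderiv ℝ (fun z => ⟪v, f z - p⟫ - ε * ‖z‖ ^ 2) y e)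
      = fun y => ⟪v, fderiv ℝ f y e⟫ - ε * (2 * ⟪e, y⟫) := by
    funext y
    have h₁ := (innerSL ℝ v).hasFDerivAt.comp y
      (((hf.differentiable (by norm_num) y).hasFDerivAt).sub_const p)
    have h₂ := h₁.sub (((hasStrictFDerivAt_norm_sq y).hasFDerivAt).const_mul ε)
    have h₃ := congrArg (fun L => L e) h₂.fderiv
    simpa [Function.comp_def, Pi.sub_def, real_inner_comm] using h₃
  rw [hfirst]
  have h₁ := (innerSL ℝ v).hasFDerivAt.comp x (hf' x).hasFDerivAt
  have h₂ := h₁.sub ((((innerSL ℝ e).hasFDerivAt (x := x)).const_mul 2).const_mul ε)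
  have h₃ := congrArg (fun L => L e) h₂.fderiv
  simpa [Function.comp_def, Pi.sub_def, he, mul_comm] using h₃

/-- No linear functional of a harmonic map on `ℝᵐ`, `m ≥ 1`, has all its sublevel sets bounded. -/
theorem IsHarmonicMap.exists_not_isBounded_sublevel {m n : ℕ} (hm : 1 ≤ m)
    {f : EuclideanSpace ℝ (Fin m) → EuclideanSpace ℝ (Fin n)} (hf : IsHarmonicMap f)
    (p v : EuclideanSpace ℝ (Fin n)) :
    ∃ c : ℝ, ¬ Bornology.IsBounded {x | ⟪v, f x - p⟫ ≤ c} := by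
  by_contra! hbdd
  obtain ⟨R, hR₀, hR⟩ := (hbdd (⟪v, f 0 - p⟫ + 1)).subset_ball_lt 0 0
  set ε : ℝ := (R ^ 2)⁻¹ with hε
  have hε₀ : 0 < ε := by positivity
  set u : EuclideanSpace ℝ (Fin m) → ℝ := fun z => ⟪v, f z - p⟫ - ε * ‖z‖ ^ 2 with hu
  have huc : ContDiff ℝ 2 u :=
    (contDiff_const.inner ℝ (hf.1.sub contDiff_const)).sub
      (contDiff_const.mul (contDiff_norm_sq ℝ))
  obtain ⟨x, hx, hmin⟩ := (isCompact_closedBall (0 : EuclideanSpace ℝ (Fin m)) R).exists_isMinOn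
    ⟨0, mem_closedBall_self hR₀.le⟩ huc.continuous.continuousOn
  have hxR : x ∈ ball (0 : EuclideanSpace ℝ (Fin m)) R := by
    by_contra hxb
    have hnorm : ‖x‖ = R := by
      simp only [mem_ball, mem_closedBall, dist_zero_right, not_lt] at hx hxb
      exact le_antisymm hx hxb
    have hlarge : ⟪v, f 0 - p⟫ + 1 < ⟪v, f x - p⟫ := by
      by_contra! hle
      exact hxb (hR hle)
    have hle : u x ≤ u 0 := hmin (mem_closedBall_self hR₀.le)
    simp only [hu, hnorm, hε, norm_zero] at hle
    rw [inv_mul_cancel₀ (by positivity)] at hle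
    linarith
  have hloc : IsLocalMin u x :=
    hmin.isLocalMin (Filter.mem_of_superset (isOpen_ball.mem_nhds hxR) ball_subset_closedBall)
  have hsum : 0 ≤ ∑ i : Fin m, (⟪v, fderiv ℝ (fun y => fderiv ℝ f y (EuclideanSpace.single i 1)) x
      (EuclideanSpace.single i 1)⟫ - 2 * ε) := by
    refine Finset.sum_nonneg fun i _ => ?_
    rw [← fderiv_fderiv_inner_sub_norm_sq hf.1 p v ε x (EuclideanSpace.single i 1) (by simp)]
    exact hloc.fderiv_fderiv_nonneg huc _
  rw [Finset.sum_sub_distrib, ← inner_sum, hf.2 x] at hsum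
  have hm' : (0 : ℝ) < m := by exact_mod_cast hm
  have : 0 < (m : ℝ) * (2 * ε) := by positivity
  simp at hsum
  linarith

/-- **Classical cone theorem** (Euclidean domain): every proper harmonic map
`f : ℝᵐ → ℝⁿ` (`m ≥ 1`) whose image is contained in the open cone of angle
`θ ∈ (0, π/2)` with vertex `p` and axis `v ≠ 0` is constant. -/
theorem classical_cone_theorem {m n : ℕ} (hm : 1 ≤ m)
    (p v : EuclideanSpace ℝ (Fin n)) (hv : v ≠ 0)
    (θ : ℝ) (hθ : θ ∈ Set.Ioo 0 (π / 2))
    (f : EuclideanSpace ℝ (Fin m) → EuclideanSpace ℝ (Fin n))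
    (hf : IsHarmonicMap f) (hproper : IsProperMap f)
    (hrange : Set.range f ⊆
      {x : EuclideanSpace ℝ (Fin n) | Real.cos θ * ‖x - p‖ * ‖v‖ < ⟪x - p, v⟫}) :
    ∃ c, ∀ x, f x = c := by
  exfalso
  obtain ⟨c, hc⟩ := hf.exists_not_isBounded_sublevel hm p v
  have hk : 0 < Real.cos θ * ‖v‖ :=
    mul_pos (Real.cos_pos_of_mem_Ioo ⟨by linarith [hθ.1, Real.pi_pos], hθ.2⟩) (norm_pos_iff.2 hv)
  refine hc ((hproper.isCompact_preimage
    (isCompact_closedBall p (c / (Real.cos θ * ‖v‖)))).isBounded.subset fun x hx => ?_)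
  have hcone : Real.cos θ * ‖f x - p‖ * ‖v‖ < ⟪f x - p, v⟫ := hrange ⟨x, rfl⟩
  have hx' : ⟪v, f x - p⟫ ≤ c := hx
  rw [real_inner_comm] at hx'
  rw [Set.mem_preimage, mem_closedBall, dist_eq_norm, le_div_iff₀ hk]
  linarith
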